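/- arXiv:math/0512191 — 2 statements merged into one kernel-verified Lean document; each statement's English description precedes it below -/
import Mathlib

section
/- Let $W$ be a random variable with values in $[0,1]$, let $n \ge 1$, $h \in \mathbb{R}$, $J \in \mathbb{R}$, and suppose that for all $0 \le k \le n$, $E[W^k(1-W)^{n-k}] = e^{h(2k-n)+(J/2)(2k-n)^2}/Z$ where $Z = \sum_{k=0}^n \binom{n}{k} e^{h(2k-n)+(J/2)(2k-n)^2}$. If $n \ge 2$, then $J \ge 0$. -/
open MeasureTheory ProbabilityTheory

/-- Cauchy–Schwarz for consecutive Bernstein moments of a `[0, 1]`-valued random variable. -/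
theorem sq_integral_bernstein_le {Ω : Type*} [MeasurableSpace Ω] (μ : Measure Ω)
    [IsFiniteMeasure μ] (W : Ω → ℝ) (hWmeas : Measurable W)
    (hW : ∀ ω, W ω ∈ Set.Icc (0 : ℝ) 1) (m : ℕ)
    (hpos : 0 < ∫ ω, W ω ^ 2 * (1 - W ω) ^ m ∂μ) :
    (∫ ω, W ω * (1 - W ω) ^ (m + 1) ∂μ) ^ 2 ≤
      (∫ ω, (1 - W ω) ^ (m + 2) ∂μ) * ∫ ω, W ω ^ 2 * (1 - W ω) ^ m ∂μ := by
  have hint (i j : ℕ) : Integrable (fun ω ↦ W ω ^ i * (1 - W ω) ^ j) μ := by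
    refine Integrable.of_bound (C := 1) (by fun_prop) (.of_forall fun ω ↦ ?_)
    have h0 : 0 ≤ W ω := (hW ω).1
    have h1 : 0 ≤ 1 - W ω := sub_nonneg.2 (hW ω).2
    rw [Real.norm_of_nonneg (by positivity)]
    exact mul_le_one₀ (pow_le_one₀ h0 (hW ω).2) (by positivity)
      (pow_le_one₀ h1 (by linarith))
  have i0 : Integrable (fun ω ↦ (1 - W ω) ^ (m + 2)) μ := by simpa using hint 0 (m + 2)
  have i1 : Integrable (fun ω ↦ W ω * (1 - W ω) ^ (m + 1)) μ := by simpa using hint 1 (m + 1)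
  have i2 := hint 2 m
  set A := ∫ ω, (1 - W ω) ^ (m + 2) ∂μ
  set B := ∫ ω, W ω * (1 - W ω) ^ (m + 1) ∂μ
  set C := ∫ ω, W ω ^ 2 * (1 - W ω) ^ m ∂μ
  have key : 0 ≤ ∫ ω, (1 - W ω) ^ m * (C * (1 - W ω) - B * W ω) ^ 2 ∂μ := by
    refine integral_nonneg fun ω ↦ ?_
    have h1 : 0 ≤ 1 - W ω := sub_nonneg.2 (hW ω).2
    positivity
  have expand : ∫ ω, (1 - W ω) ^ m * (C * (1 - W ω) - B * W ω) ^ 2 ∂μ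
      = C ^ 2 * A - 2 * B * C * B + B ^ 2 * C := by
    calc _ = ∫ ω, (C ^ 2 * (1 - W ω) ^ (m + 2) - 2 * B * C * (W ω * (1 - W ω) ^ (m + 1)))
          + B ^ 2 * (W ω ^ 2 * (1 - W ω) ^ m) ∂μ := by
          congr 1 with ω
          ring
      _ = _ := by
          rw [integral_add (by fun_prop) (by fun_prop), integral_sub (by fun_prop) (by fun_prop),
            integral_const_mul, integral_const_mul, integral_const_mul]
  rw [expand] at key
  have hprod : 0 ≤ C * (A * C - B ^ 2) := by linarith
  exact sub_nonneg.1 (nonneg_of_mul_nonneg_right hprod hpos)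

theorem stmt_2 {Ω : Type*} [MeasureSpace Ω] [IsProbabilityMeasure (ℙ : Measure Ω)]
    (W : Ω → ℝ) (hWmeas : Measurable W) (hW : ∀ ω, W ω ∈ Set.Icc (0 : ℝ) 1)
    (n : ℕ) (hn : 2 ≤ n) (h J : ℝ)
    (Z : ℝ)
    (hZ : Z = ∑ k ∈ Finset.range (n + 1), (n.choose k : ℝ) *
      Real.exp (h * (2 * (k : ℝ) - n) + J / 2 * (2 * (k : ℝ) - n) ^ 2))
    (hmom : ∀ k ≤ n, ∫ ω, (W ω) ^ k * (1 - W ω) ^ (n - k)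
      = Real.exp (h * (2 * (k : ℝ) - n) + J / 2 * (2 * (k : ℝ) - n) ^ 2) / Z) :
    0 ≤ J := by
  have hZpos : 0 < Z := by
    rw [hZ]
    refine Finset.sum_pos (fun k hk ↦ ?_) ⟨0, by simp⟩
    have := Nat.choose_pos (Nat.lt_succ_iff.1 (Finset.mem_range.1 hk))
    positivity
  obtain ⟨m, rfl⟩ := Nat.exists_eq_add_of_le' hn
  have e0 := hmom 0 (by omega)
  have e1 := hmom 1 (by omega)
  have e2 := hmom 2 (by omega)
  have s1 : m + 2 - 1 = m + 1 := by omega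
  simp only [pow_zero, one_mul, Nat.sub_zero] at e0
  simp only [pow_one, s1] at e1
  simp only [Nat.add_sub_cancel] at e2
  have key := sq_integral_bernstein_le ℙ W hWmeas hW m (by rw [e2]; positivity)
  rw [e0, e1, e2, div_pow, div_mul_div_comm, ← pow_two Z,
    div_le_div_iff_of_pos_right (by positivity), pow_two, ← Real.exp_add, ← Real.exp_add,
    Real.exp_le_exp] at key
  push_cast at key
  linarith
end

section
/- Let $\nu$ be a probability measure on $\mathbb{R}^s$ such that $\int e^{v \cdot y}\,d\nu(y) < \infty$ for all $v \in \mathbb{R}^s$, and let $n \ge 1$ be such that $Z := \int_{(\mathbb{R}^s)^n} e^{(1/2)\sum_{i,j=1}^n x_i \cdot x_j}\, d\nu^{\otimes n} < \infty$. For $w \in \mathbb{R}^s$ let $P_w$ be the probability measure with $dP_w/d\nu(x) = e^{w\cdot x}/\int e^{w\cdot y}d\nu(y)$, and let $F$ be the probability measure on $\mathbb{R}^s$ with density $\rho(w) = (\int e^{w\cdot x}d\nu(x))^n e^{-\|w\|^2/2}/(Z (2\pi)^{s/2})$ with respect to Lebesgue measure. Then the measure $\mu$ on $(\mathbb{R}^s)^n$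 with $d\mu/d\nu^{\otimes n}(x_1,\dots,x_n) = e^{(1/2)\sum_{i,j} x_i\cdot x_j}/Z$ satisfies $\mu = \int_{\mathbb{R}^s} P_w^{\otimes n}\, dF(w)$. -/
open MeasureTheory
open scoped RealInnerProductSpace

open scoped ENNReal

/-- The product of measures with densities has the product density. -/
theorem pi_withDensity_eq_withDensity_prod {ι α : Type*} [Fintype ι] [MeasurableSpace α]
    (ν : Measure α) [IsProbabilityMeasure ν] {f : α → ℝ≥0∞} (hf : Measurable f)
    [SigmaFinite (ν.withDensity f)] :
    (Measure.pi fun _ : ι => ν.withDensity f) =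
      (Measure.pi fun _ : ι => ν).withDensity fun x => ∏ i, f (x i) := by
  classical
  refine Measure.pi_eq fun t ht => ?_
  rw [withDensity_apply _ (MeasurableSet.univ_pi ht),
    ← lintegral_indicator (MeasurableSet.univ_pi ht)]
  have hind : (fun x : ι → α => (Set.univ.pi t).indicator (fun x => ∏ i, f (x i)) x) =
      fun x => ∏ i, (t i).indicator f (x i) := by
    ext x
    by_cases hx : x ∈ Set.univ.pi t
    · rw [Set.indicator_of_mem hx]
      exact Finset.prod_congr rfl fun i _ =>
        (Set.indicator_of_mem (hx i (Set.mem_univ i)) f).symm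
    · rw [Set.indicator_of_notMem hx]
      obtain ⟨i, hi⟩ : ∃ i, x i ∉ t i := by simpa [Set.mem_pi] using hx
      exact (Finset.prod_eq_zero (Finset.mem_univ i) (Set.indicator_of_notMem hi f)).symm
  have hmeas (i : ι) : Measurable ((t i).indicator f) := hf.indicator (ht i)
  have hindep := ProbabilityTheory.iIndepFun_pi (μ := fun _ : ι => ν)
    (X := fun i => (t i).indicator f) fun i => (hmeas i).aemeasurable
  rw [hind, ProbabilityTheory.lintegral_prod_eq_prod_lintegral_of_indepFun Finset.univ _ hindep
    fun i => (hmeas i).comp (measurable_pi_apply i)]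
  refine Finset.prod_congr rfl fun i _ => ?_
  rw [(measurePreserving_eval (fun _ : ι => ν) i).lintegral_comp (hmeas i),
    lintegral_indicator (ht i), withDensity_apply _ (ht i)]

/-- The Gaussian moment generating function, as a lower Lebesgue integral. -/
theorem lintegral_exp_inner_sub_half_norm_sq {V : Type*} [NormedAddCommGroup V]
    [InnerProductSpace ℝ V] [FiniteDimensional ℝ V] [MeasurableSpace V] [BorelSpace V] (v : V) :
    ∫⁻ w : V, ENNReal.ofReal (Real.exp (⟪w, v⟫ - ‖w‖ ^ 2 / 2)) =
      ENNReal.ofReal ((2 * Real.pi) ^ ((Module.finrank ℝ V : ℝ) / 2) *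
        Real.exp (‖v‖ ^ 2 / 2)) := by
  have hsq (w : V) : ENNReal.ofReal (Real.exp (⟪w, v⟫ - ‖w‖ ^ 2 / 2)) =
      ENNReal.ofReal (Real.exp (-(1 / 2) * ‖w - v‖ ^ 2)) *
        ENNReal.ofReal (Real.exp (‖v‖ ^ 2 / 2)) := by
    rw [← ENNReal.ofReal_mul (Real.exp_pos _).le, ← Real.exp_add, norm_sub_sq_real]
    ring_nf
  have hint : ∫ w : V, Real.exp (-(1 / 2) * ‖w‖ ^ 2) =
      (2 * Real.pi) ^ ((Module.finrank ℝ V : ℝ) / 2) := by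
    rw [GaussianFourier.integral_rexp_neg_mul_sq_norm (by norm_num)]
    ring_nf
  have hpos : (0 : ℝ) < (2 * Real.pi) ^ ((Module.finrank ℝ V : ℝ) / 2) := by positivity
  have hintegrable : Integrable fun w : V => Real.exp (-(1 / 2) * ‖w‖ ^ 2) :=
    Integrable.of_integral_ne_zero (hint ▸ hpos.ne')
  simp_rw [hsq]
  rw [lintegral_mul_const' _ _ ENNReal.ofReal_ne_top,
    lintegral_sub_right_eq_self (fun w : V => ENNReal.ofReal (Real.exp (-(1 / 2) * ‖w‖ ^ 2))) v,
    ← ofReal_integral_eq_lintegral_ofReal hintegrable (ae_of_all _ fun _ => (Real.exp_pos _).le),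
    hint, ENNReal.ofReal_mul hpos.le]

theorem sum_sum_inner_eq_norm_sum_sq {ι V : Type*} [Fintype ι] [NormedAddCommGroup V]
    [InnerProductSpace ℝ V] (x : ι → V) : ∑ i, ∑ j, ⟪x i, x j⟫ = ‖∑ i, x i‖ ^ 2 := by
  simp_rw [← real_inner_self_eq_norm_sq, sum_inner, inner_sum]

theorem stmt_4 (s n : ℕ) (hn : 1 ≤ n)
    (ν : Measure (EuclideanSpace ℝ (Fin s))) [IsProbabilityMeasure ν]
    (hexp : ∀ v : EuclideanSpace ℝ (Fin s),
      Integrable (fun y => Real.exp ⟪v, y⟫) ν)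
    (Z : ℝ)
    (hZ : Z = ∫ x : Fin n → EuclideanSpace ℝ (Fin s),
        Real.exp ((1 / 2) * ∑ i, ∑ j, ⟪x i, x j⟫) ∂(Measure.pi fun _ : Fin n => ν))
    (hZfin : Integrable
      (fun x : Fin n → EuclideanSpace ℝ (Fin s) =>
        Real.exp ((1 / 2) * ∑ i, ∑ j, ⟪x i, x j⟫))
      (Measure.pi fun _ : Fin n => ν))
    (P : EuclideanSpace ℝ (Fin s) → Measure (EuclideanSpace ℝ (Fin s)))
    (hP : ∀ w, P w = ν.withDensity fun x =>
      ENNReal.ofReal (Real.exp ⟪w, x⟫ / ∫ y, Real.exp ⟪w, y⟫ ∂ν))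
    (F : Measure (EuclideanSpace ℝ (Fin s)))
    (hF : F = volume.withDensity fun w =>
      ENNReal.ofReal ((∫ x, Real.exp ⟪w, x⟫ ∂ν) ^ n * Real.exp (-‖w‖ ^ 2 / 2)
        / (Z * (2 * Real.pi) ^ ((s : ℝ) / 2))))
    (μ : Measure (Fin n → EuclideanSpace ℝ (Fin s)))
    (hμ : μ = (Measure.pi fun _ : Fin n => ν).withDensity fun x =>
      ENNReal.ofReal (Real.exp ((1 / 2) * ∑ i, ∑ j, ⟪x i, x j⟫) / Z)) :
    μ = F.bind fun w => Measure.pi fun _ : Fin n => P w := by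
  let M : EuclideanSpace ℝ (Fin s) → ℝ := fun w => ∫ y, Real.exp ⟪w, y⟫ ∂ν
  have hMpos (w) : 0 < M w := integral_exp_pos (hexp w)
  have hMmeas : Measurable M := by
    refine StronglyMeasurable.measurable (StronglyMeasurable.integral_prod_right
      (f := fun w y => Real.exp ⟪w, y⟫) ?_)
    exact Continuous.stronglyMeasurable (by fun_prop)
  have hZpos : 0 < Z := hZ ▸ integral_exp_pos hZfin
  have hprob (w) : IsProbabilityMeasure (ν.withDensity fun x =>
      ENNReal.ofReal (Real.exp ⟪w, x⟫ / M w)) := isProbabilityMeasure_tilted (hexp w)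
  have hpi (w) : (Measure.pi fun _ : Fin n => P w) = (Measure.pi fun _ : Fin n => ν).withDensity
      fun x => ENNReal.ofReal (Real.exp ⟪w, ∑ i, x i⟫ / M w ^ n) := by
    have := hprob w
    simp_rw [hP w]
    rw [pi_withDensity_eq_withDensity_prod ν (by fun_prop)]
    congr with x
    rw [← ENNReal.ofReal_prod_of_nonneg fun i _ => div_nonneg (Real.exp_pos _).le (hMpos w).le,
      Finset.prod_div_distrib, ← Real.exp_sum, inner_sum]
    simp
  have hdens : Measurable fun p : EuclideanSpace ℝ (Fin s) × (Fin n → EuclideanSpace ℝ (Fin s)) =>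
      ENNReal.ofReal (Real.exp ⟪p.1, ∑ i, p.2 i⟫ / M p.1 ^ n) := by fun_prop
  have hkernel : Measurable fun w => Measure.pi fun _ : Fin n => P w := by
    refine Measure.measurable_of_measurable_coe _ fun A hA => ?_
    simp_rw [hpi, withDensity_apply _ hA]
    exact hdens.lintegral_prod_right'
  have hF' : F = volume.withDensity fun w => ENNReal.ofReal
      (M w ^ n * Real.exp (-‖w‖ ^ 2 / 2) / (Z * (2 * Real.pi) ^ ((s : ℝ) / 2))) := hF
  ext A hA
  have heval : Measurable fun w => (Measure.pi fun _ : Fin n => P w) A :=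
    (Measure.measurable_coe hA).comp hkernel
  rw [Measure.bind_apply hA hkernel.aemeasurable, hμ, hF', withDensity_apply _ hA,
    lintegral_withDensity_eq_lintegral_mul _ (by fun_prop) heval]
  have hcancel (w : EuclideanSpace ℝ (Fin s)) (x : Fin n → EuclideanSpace ℝ (Fin s)) :
      ENNReal.ofReal (M w ^ n * Real.exp (-‖w‖ ^ 2 / 2) / (Z * (2 * Real.pi) ^ ((s : ℝ) / 2))) *
        ENNReal.ofReal (Real.exp ⟪w, ∑ i, x i⟫ / M w ^ n) =
      ENNReal.ofReal (Z * (2 * Real.pi) ^ ((s : ℝ) / 2))⁻¹ *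
        ENNReal.ofReal (Real.exp (⟪w, ∑ i, x i⟫ - ‖w‖ ^ 2 / 2)) := by
    have := hMpos w
    rw [← ENNReal.ofReal_mul (by positivity), ← ENNReal.ofReal_mul (by positivity),
      sub_eq_add_neg, Real.exp_add, neg_div]
    congr 1
    field_simp
  simp only [Pi.mul_apply, hpi, withDensity_apply _ hA]
  simp_rw [← lintegral_const_mul' _ _ ENNReal.ofReal_ne_top, hcancel]
  rw [lintegral_lintegral_swap (Measurable.aemeasurable (by fun_prop))]
  refine lintegral_congr fun x => ?_
  rw [lintegral_const_mul' _ _ ENNReal.ofReal_ne_top, lintegral_exp_inner_sub_half_norm_sq,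
    ← ENNReal.ofReal_mul (by positivity), finrank_euclideanSpace_fin, sum_sum_inner_eq_norm_sum_sq]
  congr 1
  field_simp
end
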